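/- Let G be a group with Kazhdan's property (T), acting on a countable set S. If there exists a G-invariant mean on S, then some point of S has a finite orbit; equivalently, some stabilizer subgroup has finite index in G. -/

import Mathlib

open MeasureTheory Pointwise

section LpPermutation

variable {S : Type*} {p : ENNReal}

theorem Memℓp.comp_equiv (hp : 0 < p.toReal) {f : S → ℝ} (hf : Memℓp f p) (e : S ≃ S) :
    Memℓp (f ∘ e) p :=
  (memℓp_gen_iff hp).2 ((e.summable_iff (f := fun i => ‖f i‖ ^ p.toReal)).2 (hf.summable hp))

/-- The isometry of `ℓ^p(S)` given by precomposition with a permutation of `S`. -/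
noncomputable def lpCompEquiv [Fact (1 ≤ p)] (hp : 0 < p.toReal) (e : S ≃ S) :
    lp (fun _ : S => ℝ) p ≃ₗᵢ[ℝ] lp (fun _ : S => ℝ) p where
  toFun f := ⟨f ∘ e, (lp.memℓp f).comp_equiv hp e⟩
  invFun f := ⟨f ∘ e.symm, (lp.memℓp f).comp_equiv hp e.symm⟩
  map_add' _ _ := rfl
  map_smul' _ _ := rfl
  left_inv f := by ext s; exact congrArg f (e.apply_symm_apply s)
  right_inv f := by ext s; exact congrArg f (e.symm_apply_apply s)
  norm_map' f := by
    rw [lp.norm_eq_tsum_rpow hp, lp.norm_eq_tsum_rpow hp f]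
    exact congrArg (· ^ (1 / p.toReal)) (e.tsum_eq fun i => ‖f i‖ ^ p.toReal)

/-- The permutation representation of a group on `ℓ^p(S)`. -/
noncomputable def lpPermRep (G : Type*) [Group G] [MulAction G S] [Fact (1 ≤ p)]
    (hp : 0 < p.toReal) : G →* (lp (fun _ : S => ℝ) p ≃ₗᵢ[ℝ] lp (fun _ : S => ℝ) p) where
  toFun g := lpCompEquiv hp (MulAction.toPerm g⁻¹)
  map_one' := by
    ext f s
    change f ((1 : G)⁻¹ • s) = f s
    simp
  map_mul' g h := by
    ext f s
    change f ((g * h)⁻¹ • s) = f (h⁻¹ • g⁻¹ • s)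
    simp [mul_smul]

theorem lpPermRep_apply {G : Type*} [Group G] [MulAction G S] [Fact (1 ≤ p)]
    (hp : 0 < p.toReal) (g : G) (f : lp (fun _ : S => ℝ) p) (s : S) :
    lpPermRep G hp g f s = f (g⁻¹ • s) := rfl

theorem lpPermRep_single {G : Type*} [Group G] [MulAction G S] [DecidableEq S] [Fact (1 ≤ p)]
    (hp : 0 < p.toReal) (g : G) (s : S) (a : ℝ) :
    lpPermRep G hp g (lp.single p s a) = lp.single p (g • s) a := by
  ext t
  rw [lpPermRep_apply, lp.single_apply, lp.single_apply]
  by_cases h : t = g • s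
  · subst h; simp
  · rw [Pi.single_eq_of_ne h, Pi.single_eq_of_ne]
    rwa [Ne, inv_smul_eq_iff]

theorem lp.summable_norm_one (f : lp (fun _ : S => ℝ) 1) : Summable fun s => ‖f s‖ := by
  simpa using (lp.memℓp f).summable (by simp)

theorem lp.norm_one_eq_tsum (f : lp (fun _ : S => ℝ) 1) : ‖f‖ = ∑' s, ‖f s‖ := by
  simpa using lp.norm_rpow_eq_tsum (p := 1) (by simp) f

theorem lp.norm_two_sq_eq_tsum (f : lp (fun _ : S => ℝ) 2) : ‖f‖ ^ 2 = ∑' s, (f s) ^ 2 := by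
  simpa using lp.norm_rpow_eq_tsum (p := 2) (by simp) f

theorem lp.summable_sq (f : lp (fun _ : S => ℝ) 2) : Summable fun s => (f s) ^ 2 := by
  simpa using (lp.memℓp f).summable (p := 2) (by simp)

end LpPermutation

theorem Real.sq_sqrt_sub_sqrt_le {a b : ℝ} (ha : 0 ≤ a) (hb : 0 ≤ b) :
    (√a - √b) ^ 2 ≤ |a - b| := by
  have h1 : a - b = (√a - √b) * (√a + √b) := by
    nlinarith [Real.sq_sqrt ha, Real.sq_sqrt hb]
  rw [h1, abs_mul, ← sq_abs, sq, abs_of_nonneg (a := √a + √b) (by positivity)]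
  gcongr
  rw [abs_le]
  constructor <;> linarith [Real.sqrt_nonneg a, Real.sqrt_nonneg b]

section Mean

variable {S : Type*} [MeasurableSpace S]

/-- The integral of a simple function against a finitely additive set function. -/
noncomputable def meanIntegral (m : Set S → ℝ) (f : SimpleFunc S ℝ) : ℝ :=
  f.setToSimpleFunc fun A => m A • ContinuousLinearMap.id ℝ ℝ

theorem finMeasAdditive_smul_id {m : Set S → ℝ}
    (hadd : ∀ A B, Disjoint A B → m (A ∪ B) = m A + m B) :
    FinMeasAdditive (0 : Measure S) fun A => m A • ContinuousLinearMap.id ℝ ℝ := by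
  intro A B _ _ _ _ h
  simp only [hadd A B h, add_smul]

theorem meanIntegral_add {m : Set S → ℝ}
    (hadd : ∀ A B, Disjoint A B → m (A ∪ B) = m A + m B) (f g : SimpleFunc S ℝ) :
    meanIntegral m (f + g) = meanIntegral m f + meanIntegral m g :=
  SimpleFunc.setToSimpleFunc_add _ (finMeasAdditive_smul_id hadd) integrable_zero_measure
    integrable_zero_measure

theorem meanIntegral_sub {m : Set S → ℝ}
    (hadd : ∀ A B, Disjoint A B → m (A ∪ B) = m A + m B) (f g : SimpleFunc S ℝ) :
    meanIntegral m (f - g) = meanIntegral m f - meanIntegral m g :=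
  SimpleFunc.setToSimpleFunc_sub _ (finMeasAdditive_smul_id hadd) integrable_zero_measure
    integrable_zero_measure

theorem meanIntegral_eq_sum (m : Set S → ℝ) (f : SimpleFunc S ℝ) :
    meanIntegral m f = ∑ x ∈ f.range, m (f ⁻¹' {x}) * x := by
  simp [meanIntegral, SimpleFunc.setToSimpleFunc]

theorem meanIntegral_nonneg {m : Set S → ℝ} (hm : ∀ A, 0 ≤ m A) {f : SimpleFunc S ℝ}
    (hf : ∀ s, 0 ≤ f s) : 0 ≤ meanIntegral m f := by
  rw [meanIntegral_eq_sum]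
  refine Finset.sum_nonneg fun x hx => mul_nonneg (hm _) ?_
  obtain ⟨s, rfl⟩ := SimpleFunc.mem_range.1 hx
  exact hf s

theorem meanIntegral_const {m : Set S → ℝ} [Nonempty S] (hm : m Set.univ = 1) (c : ℝ) :
    meanIntegral m (SimpleFunc.const S c) = c := by
  rw [meanIntegral_eq_sum, SimpleFunc.range_const]
  have h : Function.const S c ⁻¹' {c} = Set.univ := by ext; simp
  simp [h, hm]

variable [DiscreteMeasurableSpace S]

/-- Precomposition of a simple function with the action of a group element. -/
def SimpleFunc.compSMul {G : Type*} [Group G] [MulAction G S] (f : SimpleFunc S ℝ) (g : G) :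
    SimpleFunc S ℝ :=
  f.comp (g • ·) .of_discrete

theorem meanIntegral_compSMul {G : Type*} [Group G] [MulAction G S] {m : Set S → ℝ}
    (hm : ∀ (g : G) (A : Set S), m (g • A) = m A) (f : SimpleFunc S ℝ) (g : G) :
    meanIntegral m (SimpleFunc.compSMul f g) = meanIntegral m f := by
  have hr : (SimpleFunc.compSMul f g).range = f.range := by
    ext x
    rw [SimpleFunc.mem_range, SimpleFunc.mem_range]
    exact iff_of_eq (congrArg (x ∈ ·) ((MulAction.surjective g).range_comp f))
  rw [meanIntegral_eq_sum, meanIntegral_eq_sum, hr]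
  refine Finset.sum_congr rfl fun x _ => ?_
  rw [← hm g⁻¹ (f ⁻¹' {x}), ← Set.preimage_smul]
  rfl

theorem exists_simpleFunc_approx {φ : S → ℝ} {B : ℝ} (hφ : ∀ s, |φ s| ≤ B) {η : ℝ} (hη : 0 < η) :
    ∃ ψ : SimpleFunc S ℝ, ∀ s, |φ s - ψ s| ≤ η := by
  have hfin : (Set.range fun s => η * (⌊φ s / η⌋ : ℝ)).Finite := by
    refine ((Set.finite_Icc ⌊-B / η⌋ ⌊B / η⌋).image fun n : ℤ => η * (n : ℝ)).subset ?_
    rintro _ ⟨s, rfl⟩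
    have := abs_le.1 (hφ s)
    refine ⟨⌊φ s / η⌋, ⟨Int.floor_mono ?_, Int.floor_mono ?_⟩, rfl⟩ <;> gcongr
    · exact this.1
    · exact this.2
  refine ⟨⟨_, fun _ => .of_discrete, hfin⟩, fun s => ?_⟩
  change |φ s - η * (⌊φ s / η⌋ : ℝ)| ≤ η
  have h : φ s - η * (⌊φ s / η⌋ : ℝ) = η * Int.fract (φ s / η) := by
    rw [Int.fract]
    field_simp
  rw [h, abs_of_nonneg (mul_nonneg hη.le (Int.fract_nonneg _))]
  exact mul_le_of_le_one_right hη.le (Int.fract_lt_one _).le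

/-- With respect to an invariant mean, a finite sum of bounded coboundaries `φ (g • s) - φ s`
has mean zero, hence is not bounded below by a positive constant. -/
theorem exists_sum_coboundary_lt {G : Type*} [Group G] [MulAction G S] {m : Set S → ℝ}
    (huniv : m Set.univ = 1) (hnonneg : ∀ A, 0 ≤ m A)
    (hadd : ∀ A B, Disjoint A B → m (A ∪ B) = m A + m B)
    (hinv : ∀ (g : G) (A : Set S), m (g • A) = m A) {ι : Type*} [Fintype ι] (γ : ι → G)
    (φ : ι → S → ℝ) {B : ℝ} (hφ : ∀ i s, |φ i s| ≤ B) {δ : ℝ} (hδ : 0 < δ) :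
    ∃ s, ∑ i, (φ i (γ i • s) - φ i s) < δ := by
  by_contra! hcon
  have hne : Nonempty S := by
    by_contra h
    rw [not_nonempty_iff] at h
    have := hadd ∅ ∅ (by simp)
    rw [Set.univ_eq_empty_iff.2 h] at huniv
    simp [huniv] at this
  set n : ℝ := (Fintype.card ι : ℝ) with hn
  have hn0 : 0 ≤ n := Nat.cast_nonneg _
  set η : ℝ := δ / (2 * (2 * n + 1)) with hη
  have hη0 : 0 < η := by positivity
  choose ψ hψ using fun i => exists_simpleFunc_approx (hφ i) hη0
  set Ψ : SimpleFunc S ℝ := ∑ i, (SimpleFunc.compSMul (ψ i) (γ i) - ψ i) with hΨ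
  have hzero : meanIntegral m (0 : SimpleFunc S ℝ) = 0 := by
    simpa using meanIntegral_sub hadd 0 0
  have hΨ0 : meanIntegral m Ψ = 0 := by
    refine Finset.sum_induction _ (fun f => meanIntegral m f = 0) ?_ hzero ?_
    · intro f g hf hg
      rw [meanIntegral_add hadd, hf, hg, add_zero]
    · intro i _
      rw [meanIntegral_sub hadd, meanIntegral_compSMul hinv, sub_self]
  have hΨs (s : S) : Ψ s = ∑ i, (ψ i (γ i • s) - ψ i s) := by
    let ev : SimpleFunc S ℝ →+ ℝ := ⟨⟨fun f => f s, rfl⟩, fun _ _ => rfl⟩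
    exact map_sum ev _ _
  have hlow (s : S) : δ / 2 ≤ Ψ s := by
    have h1 : ∑ i, (φ i (γ i • s) - φ i s) ≤ ∑ i, (ψ i (γ i • s) - ψ i s + 2 * η) := by
      refine Finset.sum_le_sum fun i _ => ?_
      have h2 := (abs_le.1 (hψ i (γ i • s))).2
      have h3 := (abs_le.1 (hψ i s)).1
      linarith
    rw [Finset.sum_add_distrib, ← hΨs] at h1
    simp only [Finset.sum_const, Finset.card_univ, nsmul_eq_mul, ← hn] at h1
    have h4 : (2 * n + 1) * η = δ / 2 := by rw [hη]; field_simp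
    linarith [hcon s]
  have := meanIntegral_nonneg hnonneg (f := Ψ - SimpleFunc.const S (δ / 2))
    fun s => sub_nonneg.2 (hlow s)
  rw [meanIntegral_sub hadd, hΨ0, meanIntegral_const huniv] at this
  linarith

end Mean

section Reiter

variable {S : Type*} {G : Type*} [Group G] [MulAction G S]

/-- Day's theorem: an invariant mean yields almost invariant probability vectors in `ℓ¹`. -/
theorem exists_almost_invariant_lp_one {m : Set S → ℝ}
    (huniv : m Set.univ = 1) (hnonneg : ∀ A, 0 ≤ m A)
    (hadd : ∀ A B, Disjoint A B → m (A ∪ B) = m A + m B)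
    (hinv : ∀ (g : G) (A : Set S), m (g • A) = m A) (F : Finset G) {ε : ℝ} (hε : 0 < ε) :
    ∃ f : lp (fun _ : S => ℝ) 1, (∀ s, 0 ≤ f s) ∧ ∑' s, f s = 1 ∧
      ∀ g ∈ F, ‖lpPermRep G (by simp) g f - f‖ < ε := by
  classical
  let E := lp (fun _ : S => ℝ) 1
  let K : Set E := {f | (∀ s, 0 ≤ f s) ∧ ∑' s, f s = 1}
  have hsum (f : E) : Summable fun s => f s := (lp.summable_norm_one f).of_norm
  have hK : Convex ℝ K := by
    intro f hf g hg a b ha hb hab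
    refine ⟨fun s => ?_, ?_⟩
    · exact add_nonneg (mul_nonneg ha (hf.1 s)) (mul_nonneg hb (hg.1 s))
    · change ∑' s, (a * f s + b * g s) = 1
      rw [((hsum f).mul_left a).tsum_add ((hsum g).mul_left b), tsum_mul_left, tsum_mul_left,
        hf.2, hg.2, mul_one, mul_one, hab]
  let D : E →ₗ[ℝ] (F → E) := LinearMap.pi fun g =>
    (lpPermRep G (p := 1) (by simp) (g : G)).toLinearEquiv.toLinearMap - LinearMap.id
  suffices h0 : (0 : F → E) ∈ closure (D '' K) by
    obtain ⟨_, ⟨f, hf, rfl⟩, hdist⟩ := Metric.mem_closure_iff.1 h0 ε hε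
    refine ⟨f, hf.1, hf.2, fun g hg => ?_⟩
    rw [dist_comm, dist_zero_right] at hdist
    exact (norm_le_pi_norm (D f) ⟨g, hg⟩).trans_lt hdist
  by_contra h0
  obtain ⟨Λ, u, hu0, hu⟩ := geometric_hahn_banach_point_closed
    (hK.linear_image D).closure isClosed_closure h0
  rw [map_zero] at hu0
  let φ : F → S → ℝ := fun g s => Λ (Pi.single g (lp.single 1 s 1))
  have hφ (g : F) (s : S) : |φ g s| ≤ ‖Λ‖ := by
    refine (Λ.le_opNorm _).trans ?_
    rw [Pi.norm_single, lp.norm_single (by simp), norm_one, mul_one]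
  let _ : MeasurableSpace S := ⊤
  obtain ⟨s, hs⟩ := exists_sum_coboundary_lt huniv hnonneg hadd hinv (fun g : F => (g : G)) φ hφ hu0
  have hmem : lp.single 1 s 1 ∈ K := by
    refine ⟨fun t => ?_, ?_⟩
    · rw [lp.single_apply]
      exact (Pi.single_nonneg (i := s) (α := fun _ : S => ℝ)).2 zero_le_one t
    · simp only [lp.single_apply]
      exact tsum_pi_single s 1
  refine (hu _ (subset_closure ⟨_, hmem, rfl⟩)).not_gt ?_
  refine lt_of_eq_of_lt ?_ hs
  rw [← Finset.univ_sum_single (D (lp.single 1 s 1)), map_sum]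
  refine Finset.sum_congr rfl fun g _ => ?_
  have hDs : D (lp.single 1 s 1) g = lp.single 1 ((g : G) • s) 1 - lp.single 1 s 1 :=
    congrArg (· - _) (lpPermRep_single _ (g : G) s 1)
  rw [hDs, Pi.single_sub, map_sub]

/-- An invariant mean yields almost invariant unit vectors in `ℓ²`. -/
theorem exists_almost_invariant_lp_two {m : Set S → ℝ}
    (huniv : m Set.univ = 1) (hnonneg : ∀ A, 0 ≤ m A)
    (hadd : ∀ A B, Disjoint A B → m (A ∪ B) = m A + m B)
    (hinv : ∀ (g : G) (A : Set S), m (g • A) = m A) (F : Finset G) {ε : ℝ} (hε : 0 < ε) :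
    ∃ v : lp (fun _ : S => ℝ) 2, ‖v‖ = 1 ∧ ∀ g ∈ F, ‖lpPermRep G (by simp) g v - v‖ ≤ ε := by
  obtain ⟨f, hf0, hf1, hf⟩ :=
    exists_almost_invariant_lp_one huniv hnonneg hadd hinv F (sq_pos_of_pos hε)
  have hsum : Summable fun s => f s := (lp.summable_norm_one f).of_norm
  have hmem : Memℓp (fun s => √(f s)) 2 := by
    refine memℓp_gen ?_
    simpa [Real.sq_sqrt (hf0 _)] using hsum
  let v : lp (fun _ : S => ℝ) 2 := ⟨fun s => √(f s), hmem⟩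
  have hv (s : S) : v s = √(f s) := rfl
  refine ⟨v, ?_, fun g hg => ?_⟩
  · have h : ‖v‖ ^ 2 = 1 := by
      rw [lp.norm_two_sq_eq_tsum, ← hf1]
      exact tsum_congr fun s => Real.sq_sqrt (hf0 s)
    exact (pow_eq_one_iff_of_nonneg (norm_nonneg v) two_ne_zero).1 h
  · refine le_of_sq_le_sq ?_ hε.le
    refine le_trans ?_ (hf g hg).le
    rw [lp.norm_two_sq_eq_tsum, lp.norm_one_eq_tsum]
    refine (lp.summable_sq _).tsum_le_tsum (fun s => ?_) (lp.summable_norm_one _)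
    exact Real.sq_sqrt_sub_sqrt_le (hf0 _) (hf0 _)

/-- The support of an invariant `ℓ²` vector consists of points with finite orbit. -/
theorem exists_finite_orbit_of_invariant {v : lp (fun _ : S => ℝ) 2} (hv : v ≠ 0)
    (hinv : ∀ g : G, lpPermRep G (by simp) g v = v) : ∃ s : S, (MulAction.orbit G s).Finite := by
  obtain ⟨s, hs⟩ : ∃ s, v s ≠ 0 := by
    by_contra! h
    exact hv (lp.ext (funext h))
  refine ⟨s, ?_⟩
  have hpos : 0 < v s ^ 2 := by positivity
  have hev := (lp.summable_sq v).tendsto_cofinite_zero.eventually (gt_mem_nhds hpos)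
  refine (Filter.eventually_cofinite.1 hev).subset ?_
  rintro _ ⟨g, rfl⟩
  have h : v s = v (g • s) := by
    have := congrArg (fun w : lp (fun _ : S => ℝ) 2 => w (g • s)) (hinv g)
    simpa [lpPermRep_apply] using this
  simp [h]

end Reiter

/-- a countable group with property (T) (every isometric linear action on
a real Hilbert space with almost-invariant vectors has a nonzero invariant vector) acting
on a countable set with an invariant mean has a finite orbit. -/
theorem propertyT_mean_finite_orbit (G : Type*) [Group G] [Countable G]
    (hT : ∀ (E : Type) [NormedAddCommGroup E] [InnerProductSpace ℝ E] [CompleteSpace E]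
      (ρ : G →* (E ≃ₗᵢ[ℝ] E)),
      (∀ (F : Finset G) (ε : ℝ), 0 < ε →
        ∃ v : E, v ≠ 0 ∧ ∀ g ∈ F, ‖ρ g v - v‖ ≤ ε * ‖v‖) →
      ∃ v : E, v ≠ 0 ∧ ∀ g : G, ρ g v = v)
    (S : Type) [Countable S] [MulAction G S]
    (hmean : ∃ m : Set S → ℝ, m Set.univ = 1 ∧ (∀ A, 0 ≤ m A) ∧
      (∀ A B, Disjoint A B → m (A ∪ B) = m A + m B) ∧
      ∀ (g : G) (A : Set S), m (g • A) = m A) :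
    ∃ s : S, (MulAction.orbit G s).Finite := by
  obtain ⟨m, huniv, hnonneg, hadd, hinv⟩ := hmean
  obtain ⟨v, hv, hfix⟩ := hT (lp (fun _ : S => ℝ) 2) (lpPermRep G (by simp)) fun F ε hε => by
    obtain ⟨v, hv, h⟩ := exists_almost_invariant_lp_two huniv hnonneg hadd hinv F hε
    refine ⟨v, norm_ne_zero_iff.1 (by simp [hv]), fun g hg => ?_⟩
    rw [hv, mul_one]
    exact h g hg
  exact exists_finite_orbit_of_invariant hv hfix
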